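/- arXiv:1707.05563 — 11 statements merged into one kernel-verified Lean document; each statement's English description precedes it below -/
import Mathlib

section
/- In any associative unital ring A containing elements s₁, s₂, D₁, D₂ satisfying the defining relations of the Hecke–Hopf algebra H(W₁) of type B₂ listed in the context, the identity D₁s₂s₁D₂ = D₂D₁s₂s₁ + s₂D₁D₂s₁ + s₂s₁D₂D₁ + s₂s₁D₂s₁ + s₂D₁s₂s₁ holds. (Lemma 2.2, relation (2.7).) -/
theorem eq_of_mul_involution {A : Type*} [Monoid A] {s x y : A} (hs : s * s = 1)
    (h : x * s = y * s) : x = y := by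
  rw [← mul_one x, ← mul_one y, ← hs, ← mul_assoc, ← mul_assoc, h]

/-- If `x` commutes with the conjugate of `r` by the involution `s`, then the conjugate of `x`
by `s` commutes with `r`. -/
theorem mul_conj_comm_of_comm_mul_conj {A : Type*} [Ring A] {r s x : A}
    (hs : s * s = 1) (h : x * s * r * s = s * r * s * x) :
    r * (s * x * s) = s * x * s * r := by
  linear_combination (norm := noncomm_ring) -(s * h * s) + s * x * s * r * hs - hs * (r * s * x * s)

/-- Conjugation by `s` reverses the quadratic relation between `a`, `b`, `c`, `d`. -/
theorem reverse_relation_of_conj {A : Type*} [Ring A] {s a b c d : A}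
    (hs : s * s = 1) (ha : s * a + a * s = s - 1) (hb : s * b = d * s) (hd : s * d = b * s)
    (hc : s * c = c * s) (h : d * c + c * b + b * a = a * d + b + c) :
    a * b + b * c + c * d = d * a + b + c := by
  refine eq_of_mul_involution hs ?_
  linear_combination (norm := noncomm_ring) s * h - hd * c - b * hc - hc * b - c * hb
    - hb * a - d * ha + ha * d - a * hd + hd + hb + hc


theorem stmt_0 {A : Type*} [Ring A] (s1 s2 D1 D2 : A)
    (h1 : s1 * s1 = 1) (h2 : s2 * s2 = 1)
    (h3 : s1 * s2 * s1 * s2 = s2 * s1 * s2 * s1)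
    (h4 : D1 * D1 = D1) (h5 : D2 * D2 = D2)
    (h6 : s1 * D1 + D1 * s1 = s1 - 1) (h7 : s2 * D2 + D2 * s2 = s2 - 1)
    (h8 : D1 * s2 * s1 * s2 = s2 * s1 * s2 * D1)
    (h9 : D2 * s1 * s2 * s1 = s1 * s2 * s1 * D2)
    (h10 : D2 * s1 * s2 * D1 =
      D1 * D2 * s1 * s2 + s1 * D2 * D1 * s2 + s1 * s2 * D1 * D2 +
      s1 * s2 * D1 * s2 + s1 * D2 * s1 * s2)
    (h11 : D1 * D2 * D1 * D2 = D2 * D1 * D2 * D1) :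
    D1 * s2 * s1 * D2 = D2 * D1 * s2 * s1 + s2 * D1 * D2 * s1 + s2 * s1 * D2 * D1 + s2 * s1 * D2 * s1 + s2 * D1 * s2 * s1 := by
  have hc := mul_conj_comm_of_comm_mul_conj h2 h8
  have hb := mul_conj_comm_of_comm_mul_conj h1 h9
  obtain ⟨b, b_def⟩ : ∃ b, b = s1 * D2 * s1 := ⟨_, rfl⟩
  obtain ⟨c, c_def⟩ : ∃ c, c = s2 * D1 * s2 := ⟨_, rfl⟩
  rw [← c_def] at hc
  rw [← b_def] at hb
  have hD2 : s1 * D2 = b * s1 := by rw [b_def, mul_assoc, h1, mul_one]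
  have hD1 : s2 * D1 = c * s2 := by rw [c_def, mul_assoc, h2, mul_one]
  have hb1 : s1 * b = D2 * s1 := by rw [b_def, ← mul_assoc, ← mul_assoc, h1, one_mul]
  have hc1 : s1 * s2 * D1 = c * s1 * s2 := by rw [mul_assoc, hD1, ← mul_assoc, hc]
  have hb2 : s2 * s1 * D2 = b * s2 * s1 := by rw [mul_assoc, hD2, ← mul_assoc, hb]
  have rel : D2 * c + c * b + b * D1 = D1 * D2 + b + c := by
    refine eq_of_mul_involution h1 (eq_of_mul_involution h2 ?_)
    linear_combination (norm := noncomm_ring) h10 - D2 * hc1 + hD2 * (D1 * s2) + b * h6 * s2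
      + hc1 * D2 + c * s1 * h7 - c * hD2 * s2 + hc1 * s2 + c * s1 * h2 + hD2 * (s1 * s2)
      + b * h1 * s2
  have rel' := reverse_relation_of_conj h1 h6 hb1 hD2 hc rel
  linear_combination (norm := noncomm_ring) rel' * (s2 * s1) + D1 * hb2 - hD1 * (D2 * s1)
    - c * h7 * s1 - hb2 * D1 - b * s2 * h6 + b * hD1 * s1 - hb2 * s1 - b * s2 * h1
    - hD1 * (s2 * s1) - c * h2 * s1
end

section
/- With K, σ₁, σ₂ and the operators D̂₁, D̂₂, D̂₃, D̂₄ : K → K as in the context (type B₂ Demazure-type operators), the operator identity D̂₂ + D̂₃ + D̂₄∘D̂₁ − D̂₁∘D̂₂ − D̂₂∘D̂₃ − D̂₃∘D̂₄ = 0 holds; that is, for every f ∈ K, D̂₂(f) + D̂₃(f) + D̂₄(D̂₁(f)) − D̂₁(D̂₂(f)) − D̂₂(D̂₃(f)) − D̂₃(D̂₄(f)) = 0. (Lemma 2.3(1).) -/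
noncomputable section

local notation "K" => FractionRing (MvPolynomial (Fin 2) ℤ)

noncomputable def t1 : FractionRing (MvPolynomial (Fin 2) ℤ) :=
  algebraMap (MvPolynomial (Fin 2) ℤ) _ (MvPolynomial.X 0)

noncomputable def t2 : FractionRing (MvPolynomial (Fin 2) ℤ) :=
  algebraMap (MvPolynomial (Fin 2) ℤ) _ (MvPolynomial.X 1)

theorem one_sub_t1_pow_mul_t2_pow_ne_zero (m n : ℕ) (h : m + n ≠ 0) :
    (1 : K) - t1 ^ m * t2 ^ n ≠ 0 := by
  have hp : (1 - MvPolynomial.X 0 ^ m * MvPolynomial.X 1 ^ n : MvPolynomial (Fin 2) ℤ) ≠ 0 := by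
    intro hp
    have h0 := congrArg (MvPolynomial.eval fun _ => (0 : ℤ)) hp
    rw [map_sub, map_mul, map_pow, map_pow, MvPolynomial.eval_X, MvPolynomial.eval_X, ← pow_add,
      zero_pow h] at h0
    simp at h0
  have hK := (map_ne_zero_iff _ (IsFractionRing.injective (MvPolynomial (Fin 2) ℤ) K)).mpr hp
  simpa [t1, t2] using hK

theorem t1_ne_zero : t1 ≠ 0 :=
  (map_ne_zero_iff _ (IsFractionRing.injective (MvPolynomial (Fin 2) ℤ) K)).mpr
    (MvPolynomial.X_ne_zero 0)

theorem t2_ne_zero : t2 ≠ 0 :=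
  (map_ne_zero_iff _ (IsFractionRing.injective (MvPolynomial (Fin 2) ℤ) K)).mpr
    (MvPolynomial.X_ne_zero 1)

theorem ringHom_ext_t1_t2 {φ ψ : K →+* K} (h1 : φ t1 = ψ t1) (h2 : φ t2 = ψ t2) : φ = ψ := by
  refine IsLocalization.ringHom_ext (nonZeroDivisors (MvPolynomial (Fin 2) ℤ)) ?_
  refine MvPolynomial.ringHom_ext (fun n => by simp) fun i => ?_
  fin_cases i
  · exact h1
  · exact h2

theorem stmt_5 (σ1 σ2 : K ≃+* K)
    (h11 : σ1 t1 = t1⁻¹) (h12 : σ1 t2 = t1 ^ 2 * t2)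
    (h21 : σ2 t1 = t1 * t2) (h22 : σ2 t2 = t2⁻¹)
    (D1 D2 : K → K)
    (hD1 : ∀ f, D1 f = (1 - t1)⁻¹ * (f - σ1 f))
    (hD2 : ∀ f, D2 f = (1 - t2)⁻¹ * (f - σ2 f))
    (Dh1 Dh2 Dh3 Dh4 : K → K)
    (hDh1 : Dh1 = D1)
    (hDh2 : Dh2 = ⇑σ1 ∘ D2 ∘ ⇑σ1)
    (hDh3 : Dh3 = ⇑σ2 ∘ D1 ∘ ⇑σ2)
    (hDh4 : Dh4 = D2) :
    ∀ f : K, Dh2 f + Dh3 f + Dh4 (Dh1 f) - Dh1 (Dh2 f) - Dh2 (Dh3 f) - Dh3 (Dh4 f) = 0 := by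
  intro f
  have hx := t1_ne_zero
  have hy := t2_ne_zero
  have h10 : 1 - t1 ≠ 0 := by simpa using one_sub_t1_pow_mul_t2_pow_ne_zero 1 0 (by simp)
  have h01 : 1 - t2 ≠ 0 := by simpa using one_sub_t1_pow_mul_t2_pow_ne_zero 0 1 (by simp)
  have hxy : 1 - t1 * t2 ≠ 0 := by simpa using one_sub_t1_pow_mul_t2_pow_ne_zero 1 1 (by simp)
  have hxxy : 1 - t1 ^ 2 * t2 ≠ 0 := by
    simpa using one_sub_t1_pow_mul_t2_pow_ne_zero 2 1 (by simp)
  have s11 (g : K) : σ1 (σ1 g) = g := by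
    refine DFunLike.congr_fun (ringHom_ext_t1_t2
      (φ := (σ1 : K →+* K).comp σ1) (ψ := RingHom.id K) ?_ ?_) g
    · simp [h11]
    · simp [h11, h12]
      field_simp
  have s22 (g : K) : σ2 (σ2 g) = g := by
    refine DFunLike.congr_fun (ringHom_ext_t1_t2
      (φ := (σ2 : K →+* K).comp σ2) (ψ := RingHom.id K) ?_ ?_) g
    · simp [h21, h22]
      field_simp
    · simp [h22]
  have braid (g : K) : σ1 (σ2 (σ1 (σ2 g))) = σ2 (σ1 (σ2 (σ1 g))) := by
    refine DFunLike.congr_fun (ringHom_ext_t1_t2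
      (φ := (σ1 : K →+* K).comp ((σ2 : K →+* K).comp ((σ1 : K →+* K).comp σ2)))
      (ψ := (σ2 : K →+* K).comp ((σ1 : K →+* K).comp ((σ2 : K →+* K).comp σ1))) ?_ ?_) g
    · simp [h11, h12, h21, h22]
      field_simp
    · simp [h11, h12, h21, h22]
      field_simp
  have dh2 (g : K) : Dh2 g = (1 - t1 ^ 2 * t2)⁻¹ * (g - σ1 (σ2 (σ1 g))) := by
    simp [hDh2, hD2, s11, h12]
  have dh3 (g : K) : Dh3 g = (1 - t1 * t2)⁻¹ * (g - σ2 (σ1 (σ2 g))) := by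
    simp [hDh3, hD1, s22, h21]
  have d41 : Dh4 (Dh1 f) = (1 - t2)⁻¹ *
      ((1 - t1)⁻¹ * (f - σ1 f) - (1 - t1 * t2)⁻¹ * (σ2 f - σ2 (σ1 f))) := by
    simp [hDh4, hDh1, hD1, hD2, h21]
  have d12 : Dh1 (Dh2 f) = (1 - t1)⁻¹ *
      ((1 - t1 ^ 2 * t2)⁻¹ * (f - σ1 (σ2 (σ1 f))) - (1 - t2)⁻¹ * (σ1 f - σ2 (σ1 f))) := by
    have e : t1⁻¹ ^ 2 * (t1 ^ 2 * t2) = t2 := by field_simp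
    rw [hDh1, hD1, dh2]
    simp only [map_mul, map_inv₀, map_sub, map_one, map_pow, h11, h12, s11, e]
  have d23 : Dh2 (Dh3 f) = (1 - t1 ^ 2 * t2)⁻¹ *
      ((1 - t1 * t2)⁻¹ * (f - σ2 (σ1 (σ2 f))) -
        (1 - t1⁻¹)⁻¹ * (σ1 (σ2 (σ1 f)) - σ2 (σ1 f))) := by
    have e1 : t1⁻¹ * (t1 ^ 2 * t2) = t1 * t2 := by field_simp
    have e2 : t1 * t2 * t2⁻¹ = t1 := by field_simp
    have e3 : σ1 (σ2 (σ1 (σ2 (σ1 (σ2 f))))) = σ2 (σ1 f) := by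
      rw [braid, s11, s22]
    rw [dh2, dh3]
    simp only [map_mul, map_inv₀, map_sub, map_one, h11, h12, h21, h22, e1, e2, e3]
  have d34 : Dh3 (Dh4 f) = (1 - t1 * t2)⁻¹ *
      ((1 - t2)⁻¹ * (f - σ2 f) -
        (1 - (t1 ^ 2 * t2)⁻¹)⁻¹ * (σ2 (σ1 (σ2 f)) - σ2 (σ1 f))) := by
    have e : (t1 * t2) ^ 2 * t2⁻¹ = t1 ^ 2 * t2 := by field_simp
    rw [dh3, hDh4, hD2]
    simp only [map_mul, map_inv₀, map_sub, map_one, map_pow, h12, h21, h22, s22, e]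
  have i1 : (1 - t1⁻¹)⁻¹ = -t1 * (1 - t1)⁻¹ := by
    rw [show 1 - t1⁻¹ = -(1 - t1) * t1⁻¹ by field_simp; ring, mul_inv, inv_inv, inv_neg]
    ring
  have i2 : (1 - (t1 ^ 2 * t2)⁻¹)⁻¹ = -(t1 ^ 2 * t2) * (1 - t1 ^ 2 * t2)⁻¹ := by
    rw [show 1 - (t1 ^ 2 * t2)⁻¹ = -(1 - t1 ^ 2 * t2) * (t1 ^ 2 * t2)⁻¹ by field_simp; ring,
      mul_inv, inv_inv, inv_neg]
    ring
  rw [d41, d12, d23, d34, dh2, dh3, i1, i2]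
  field_simp
  ring
end
end

section
/- In any associative unital ring A containing elements s₁, s₂, D₁, D₂ satisfying the defining relations of the Hecke–Hopf algebra H(W₂) of type G₂ listed in the context, the identity D₂s₁s₂s₁s₂D₁ = D₁D₂s₁s₂s₁s₂ + s₁D₂D₁s₂s₁s₂ + s₁s₂D₁D₂s₁s₂ + s₁s₂s₁D₂D₁s₂ + s₁s₂s₁s₂D₁D₂ + s₁s₂D₁s₂s₁s₂ + s₁s₂s₁s₂D₁s₂ + s₁D₂s₁s₂s₁s₂ + s₁s₂s₁D₂s₁s₂ holds. (Lemma 3.2, relation (3.13).) -/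
theorem stmt_7 {A : Type*} [Ring A] (s1 s2 D1 D2 : A)
    (h1 : s1 * s1 = 1) (h2 : s2 * s2 = 1)
    (h3 : s1 * s2 * s1 * s2 * s1 * s2 = s2 * s1 * s2 * s1 * s2 * s1)
    (h4 : D1 * D1 = D1) (h5 : D2 * D2 = D2)
    (h6 : s1 * D1 + D1 * s1 = s1 - 1) (h7 : s2 * D2 + D2 * s2 = s2 - 1)
    (h8 : D1 * s2 * s1 * s2 * s1 * s2 = s2 * s1 * s2 * s1 * s2 * D1)
    (h9 : D2 * s1 * s2 * s1 * s2 * s1 = s1 * s2 * s1 * s2 * s1 * D2)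
    (h10 : D1 * s2 * s1 * s2 * s1 * D2 =
      D2 * D1 * s2 * s1 * s2 * s1 + s2 * D1 * D2 * s1 * s2 * s1 +
      s2 * s1 * D2 * D1 * s2 * s1 + s2 * s1 * s2 * D1 * D2 * s1 +
      s2 * s1 * s2 * s1 * D2 * D1 + s2 * s1 * D2 * s1 * s2 * s1 +
      s2 * s1 * s2 * s1 * D2 * s1 + s2 * D1 * s2 * s1 * s2 * s1 +
      s2 * s1 * s2 * D1 * s2 * s1)
    (h11 : D2 * s1 * s2 * D1 * s2 * s1 = s1 * s2 * D1 * s2 * s1 * D2)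
    (h12 : D1 * s2 * s1 * s2 * D1 * s2 =
      s2 * s1 * s2 * D1 * s2 * D1 + s2 * D1 * s2 * D1 * s2 * s1 +
      s2 * s1 * s2 * D1 * s2 * s1)
    (h13 : D2 * s1 * s2 * s1 * D2 * s1 =
      s1 * s2 * s1 * D2 * s1 * D2 + s1 * D2 * s1 * D2 * s1 * s2 +
      s1 * s2 * s1 * D2 * s1 * s2)
    (h14 : D2 * D1 * D2 * s1 * s2 * D1 + D2 * s1 * D2 * D1 * s2 * D1 +
      D2 * s1 * D2 * s1 * s2 * D1 + D2 * s1 * s2 * D1 * D2 * D1 +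
      D2 * s1 * s2 * D1 * s2 * D1 =
      D1 * D2 * D1 * D2 * s1 * s2 + D1 * D2 * s1 * D2 * D1 * s2 +
      D1 * D2 * s1 * D2 * s1 * s2 + D1 * D2 * s1 * s2 * D1 * D2 +
      D1 * D2 * s1 * s2 * D1 * s2 + s1 * D2 * D1 * D2 * D1 * s2 +
      s1 * D2 * D1 * D2 * s1 * s2 + s1 * D2 * D1 * s2 * D1 * D2 +
      s1 * D2 * D1 * s2 * D1 * s2 + s1 * D2 * s1 * D2 * D1 * s2 +
      s1 * D2 * s1 * D2 * s1 * s2 + s1 * D2 * s1 * s2 * D1 * D2 +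
      s1 * D2 * s1 * s2 * D1 * s2 + s1 * s2 * D1 * D2 * D1 * D2 +
      s1 * s2 * D1 * D2 * D1 * s2 + s1 * s2 * D1 * s2 * D1 * D2 +
      s1 * s2 * D1 * s2 * D1 * s2)
    (h15 : s1 * D2 * s1 * D2 * D1 * D2 + s1 * D2 * D1 * D2 * s1 * D2 +
      D1 * D2 * s1 * D2 * s1 * D2 =
      D2 * s1 * D2 * s1 * D2 * D1 + D2 * s1 * D2 * D1 * D2 * s1 +
      D2 * D1 * D2 * s1 * D2 * s1)
    (h16 : s2 * D1 * s2 * D1 * D2 * D1 + s2 * D1 * D2 * D1 * s2 * D1 +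
      D2 * D1 * s2 * D1 * s2 * D1 =
      D1 * s2 * D1 * s2 * D1 * D2 + D1 * s2 * D1 * D2 * D1 * s2 +
      D1 * D2 * D1 * s2 * D1 * s2)
    (h17 : D1 * D2 * D1 * D2 * D1 * D2 = D2 * D1 * D2 * D1 * D2 * D1) :
    D2 * s1 * s2 * s1 * s2 * D1 =
      D1 * D2 * s1 * s2 * s1 * s2 + s1 * D2 * D1 * s2 * s1 * s2 +
      s1 * s2 * D1 * D2 * s1 * s2 + s1 * s2 * s1 * D2 * D1 * s2 +
      s1 * s2 * s1 * s2 * D1 * D2 + s1 * s2 * D1 * s2 * s1 * s2 +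
      s1 * s2 * s1 * s2 * D1 * s2 + s1 * D2 * s1 * s2 * s1 * s2 +
      s1 * s2 * s1 * D2 * s1 * s2 := by
  have cancel (x : A) : s1 * (s1 * x) = x := by rw [← mul_assoc, h1, one_mul]
  have swap : s1 * D1 = s1 - 1 - D1 * s1 := eq_sub_of_add_eq h6
  have swap_mul (x : A) : s1 * (D1 * x) = s1 * x - x - D1 * (s1 * x) := by
    rw [← mul_assoc, swap, sub_mul, sub_mul, one_mul, mul_assoc]
  have shift (x : A) : s1 * (s2 * (s1 * (s2 * (s1 * (D2 * x))))) =
      D2 * (s1 * (s2 * (s1 * (s2 * (s1 * x))))) := by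
    simpa only [mul_assoc] using congrArg (· * x) h9.symm
  have shift_s1 : s2 * (s1 * (s2 * (s1 * (D2 * s1)))) =
      s1 * (D2 * (s1 * (s2 * (s1 * s2)))) := by
    rw [← cancel (s2 * (s1 * (s2 * (s1 * (D2 * s1))))), shift, h1, mul_one]
  linear_combination (norm := skip) s1 * h10 * s1
  simp only [mul_add, add_mul, mul_sub, sub_mul, mul_assoc, mul_one, h1, cancel, swap, swap_mul,
    shift, shift_s1]
  abel
end

section
/- In any associative unital ring A containing elements s₁, s₂, D₁, D₂ satisfying the defining relations of the Hecke–Hopf algebra H(W₂) of type G₂ listed in the context, the identity D₁s₂D₁s₂D₁s₂ = s₂D₁s₂D₁s₂D₁ holds. (Lemma 3.2, relation (3.18).) -/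
/-- Two idempotents `a`, `b` of a ring with `a * b = c * a + b * c - c` for some `c` satisfy the
braid relation. -/
theorem braid_of_mul_eq_add_sub {A : Type*} [Ring A] {a b c : A} (ha : a * a = a) (hb : b * b = b)
    (h : a * b = c * a + b * c - c) : a * b * a = b * a * b := by
  calc a * b * a = c * (a * a) + b * c * a - c * a := by rw [h]; noncomm_ring
    _ = b * c * a + b * b * c - b * c := by rw [ha, hb]; abel
    _ = b * (c * a + b * c - c) := by noncomm_ring
    _ = b * a * b := by rw [← h, mul_assoc]

/-- The mixed relation of the Hecke–Hopf algebra of type `A₂` implies the braid relation. -/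
theorem braid_of_mixed_relation {A : Type*} [Ring A] {a b u : A} (hu : u * u = 1)
    (ha : a * a = a) (hb : b * b = b) (hub : u * b + b * u = u - 1)
    (h : a * u * a = u * a * b + b * a * u + u * a * u) : a * b * a = b * a * b := by
  refine braid_of_mul_eq_add_sub (c := u * a * u) ha hb ?_
  have hub' : u * b = u - 1 - b * u := eq_sub_of_add_eq hub
  have key : u * a * u * a = a * b + (u - 1 - b * u) * a * u + a * u := by
    calc u * a * u * a = u * (a * u * a) := by noncomm_ring
      _ = u * u * a * b + u * b * a * u + u * u * a * u := by rw [h]; noncomm_ring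
      _ = _ := by rw [hu, hub', one_mul]
  rw [key]
  noncomm_ring

theorem stmt_8 {A : Type*} [Ring A] (s1 s2 D1 D2 : A)
    (h1 : s1 * s1 = 1) (h2 : s2 * s2 = 1)
    (h3 : s1 * s2 * s1 * s2 * s1 * s2 = s2 * s1 * s2 * s1 * s2 * s1)
    (h4 : D1 * D1 = D1) (h5 : D2 * D2 = D2)
    (h6 : s1 * D1 + D1 * s1 = s1 - 1) (h7 : s2 * D2 + D2 * s2 = s2 - 1)
    (h8 : D1 * s2 * s1 * s2 * s1 * s2 = s2 * s1 * s2 * s1 * s2 * D1)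
    (h9 : D2 * s1 * s2 * s1 * s2 * s1 = s1 * s2 * s1 * s2 * s1 * D2)
    (h10 : D1 * s2 * s1 * s2 * s1 * D2 =
      D2 * D1 * s2 * s1 * s2 * s1 + s2 * D1 * D2 * s1 * s2 * s1 +
      s2 * s1 * D2 * D1 * s2 * s1 + s2 * s1 * s2 * D1 * D2 * s1 +
      s2 * s1 * s2 * s1 * D2 * D1 + s2 * s1 * D2 * s1 * s2 * s1 +
      s2 * s1 * s2 * s1 * D2 * s1 + s2 * D1 * s2 * s1 * s2 * s1 +
      s2 * s1 * s2 * D1 * s2 * s1)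
    (h11 : D2 * s1 * s2 * D1 * s2 * s1 = s1 * s2 * D1 * s2 * s1 * D2)
    (h12 : D1 * s2 * s1 * s2 * D1 * s2 =
      s2 * s1 * s2 * D1 * s2 * D1 + s2 * D1 * s2 * D1 * s2 * s1 +
      s2 * s1 * s2 * D1 * s2 * s1)
    (h13 : D2 * s1 * s2 * s1 * D2 * s1 =
      s1 * s2 * s1 * D2 * s1 * D2 + s1 * D2 * s1 * D2 * s1 * s2 +
      s1 * s2 * s1 * D2 * s1 * s2)
    (h14 : D2 * D1 * D2 * s1 * s2 * D1 + D2 * s1 * D2 * D1 * s2 * D1 +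
      D2 * s1 * D2 * s1 * s2 * D1 + D2 * s1 * s2 * D1 * D2 * D1 +
      D2 * s1 * s2 * D1 * s2 * D1 =
      D1 * D2 * D1 * D2 * s1 * s2 + D1 * D2 * s1 * D2 * D1 * s2 +
      D1 * D2 * s1 * D2 * s1 * s2 + D1 * D2 * s1 * s2 * D1 * D2 +
      D1 * D2 * s1 * s2 * D1 * s2 + s1 * D2 * D1 * D2 * D1 * s2 +
      s1 * D2 * D1 * D2 * s1 * s2 + s1 * D2 * D1 * s2 * D1 * D2 +
      s1 * D2 * D1 * s2 * D1 * s2 + s1 * D2 * s1 * D2 * D1 * s2 +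
      s1 * D2 * s1 * D2 * s1 * s2 + s1 * D2 * s1 * s2 * D1 * D2 +
      s1 * D2 * s1 * s2 * D1 * s2 + s1 * s2 * D1 * D2 * D1 * D2 +
      s1 * s2 * D1 * D2 * D1 * s2 + s1 * s2 * D1 * s2 * D1 * D2 +
      s1 * s2 * D1 * s2 * D1 * s2)
    (h15 : s1 * D2 * s1 * D2 * D1 * D2 + s1 * D2 * D1 * D2 * s1 * D2 +
      D1 * D2 * s1 * D2 * s1 * D2 =
      D2 * s1 * D2 * s1 * D2 * D1 + D2 * s1 * D2 * D1 * D2 * s1 +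
      D2 * D1 * D2 * s1 * D2 * s1)
    (h16 : s2 * D1 * s2 * D1 * D2 * D1 + s2 * D1 * D2 * D1 * s2 * D1 +
      D2 * D1 * s2 * D1 * s2 * D1 =
      D1 * s2 * D1 * s2 * D1 * D2 + D1 * s2 * D1 * D2 * D1 * s2 +
      D1 * D2 * D1 * s2 * D1 * s2)
    (h17 : D1 * D2 * D1 * D2 * D1 * D2 = D2 * D1 * D2 * D1 * D2 * D1) :
    D1 * s2 * D1 * s2 * D1 * s2 = s2 * D1 * s2 * D1 * s2 * D1 := by
  have cancel (x : A) : s2 * (s2 * x) = x := by rw [← mul_assoc, h2, one_mul]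
  have cancel1 (x : A) : s1 * (s1 * x) = x := by rw [← mul_assoc, h1, one_mul]
  have cancelD (x : A) : D1 * (D1 * x) = D1 * x := by rw [← mul_assoc, h4]
  have hu : s2 * s1 * s2 * (s2 * s1 * s2) = 1 := by simp only [mul_assoc, cancel, cancel1, h2]
  have hb : s2 * D1 * s2 * (s2 * D1 * s2) = s2 * D1 * s2 := by
    simp only [mul_assoc, cancel, cancelD]
  have hub : s2 * s1 * s2 * (s2 * D1 * s2) + s2 * D1 * s2 * (s2 * s1 * s2) =
      s2 * s1 * s2 - 1 := by
    calc _ = s2 * (s1 * D1 + D1 * s1) * s2 := by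
          simp only [mul_assoc, cancel, mul_add, add_mul]
      _ = _ := by rw [h6, mul_sub, sub_mul, mul_one, h2]
  have mixed : D1 * (s2 * s1 * s2) * D1 = s2 * s1 * s2 * D1 * (s2 * D1 * s2) +
      s2 * D1 * s2 * D1 * (s2 * s1 * s2) + s2 * s1 * s2 * D1 * (s2 * s1 * s2) := by
    have := congrArg (· * s2) h12
    simpa only [mul_assoc, add_mul, h2, mul_one] using this
  have braid := congrArg (· * s2) (braid_of_mixed_relation hu h4 hb hub mixed)
  simpa only [mul_assoc, h2, mul_one] using braid
end

section
/- In any associative unital ring A containing elements s₁, s₂, D₁, D₂ satisfying the defining relations of the Hecke–Hopf algebra H(W₂) of type G₂ listed in the context, the identity D₂s₁D₂s₁D₂s₁ = s₁D₂s₁D₂s₁D₂ holds. (Lemma 3.2, relation (3.19).) -/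
/-- If idempotents `D`, `E` and an involution `t` satisfy the mixed quadratic relation of the
Hecke-Hopf algebra of type `A₂`, then `D` and `E` satisfy the braid relation. -/
theorem braid_of_mixed_relation_s9 {A : Type*} [Ring A] {t D E : A} (ht : t * t = 1)
    (hD : D * D = D) (hE : E * E = E) (htE : t * E + E * t = t - 1)
    (h : D * t * D = t * D * E + E * D * t + t * D * t) :
    D * E * D = E * D * E := by
  have htEt : t * E * t = 1 - t - E := by
    rw [eq_sub_of_add_eq htE, sub_mul, sub_mul, ht, one_mul, mul_assoc, ht, mul_one]
  have ht' (x : A) : t * (t * x) = x := by rw [← mul_assoc, ht, one_mul]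
  have hDE : D * E = t * D * t * D + E * (t * D * t) - t * D * t := by
    have hleft := congrArg (t * ·) h
    have hconj : t * (E * D * t) = t * D * t - D * t - E * (t * D * t) := by
      calc t * (E * D * t) = t * E * t * (t * D * t) := by simp only [mul_assoc, ht']
        _ = t * D * t - D * t - E * (t * D * t) := by
          rw [htEt]; simp only [sub_mul, one_mul, mul_assoc, ht']
    simp only [mul_add, hconj] at hleft
    simp only [mul_assoc, ht'] at hleft ⊢
    rw [hleft]
    abel
  calc D * E * D = E * (t * D * t * D) := by
        rw [hDE]; simp only [sub_mul, add_mul, mul_assoc, hD]; abel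
    _ = E * D * E := by
        rw [mul_assoc E D E, hDE, mul_sub, mul_add, ← mul_assoc E E, hE]; abel

theorem stmt_9 {A : Type*} [Ring A] (s1 s2 D1 D2 : A)
    (h1 : s1 * s1 = 1) (h2 : s2 * s2 = 1)
    (h3 : s1 * s2 * s1 * s2 * s1 * s2 = s2 * s1 * s2 * s1 * s2 * s1)
    (h4 : D1 * D1 = D1) (h5 : D2 * D2 = D2)
    (h6 : s1 * D1 + D1 * s1 = s1 - 1) (h7 : s2 * D2 + D2 * s2 = s2 - 1)
    (h8 : D1 * s2 * s1 * s2 * s1 * s2 = s2 * s1 * s2 * s1 * s2 * D1)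
    (h9 : D2 * s1 * s2 * s1 * s2 * s1 = s1 * s2 * s1 * s2 * s1 * D2)
    (h10 : D1 * s2 * s1 * s2 * s1 * D2 =
      D2 * D1 * s2 * s1 * s2 * s1 + s2 * D1 * D2 * s1 * s2 * s1 +
      s2 * s1 * D2 * D1 * s2 * s1 + s2 * s1 * s2 * D1 * D2 * s1 +
      s2 * s1 * s2 * s1 * D2 * D1 + s2 * s1 * D2 * s1 * s2 * s1 +
      s2 * s1 * s2 * s1 * D2 * s1 + s2 * D1 * s2 * s1 * s2 * s1 +
      s2 * s1 * s2 * D1 * s2 * s1)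
    (h11 : D2 * s1 * s2 * D1 * s2 * s1 = s1 * s2 * D1 * s2 * s1 * D2)
    (h12 : D1 * s2 * s1 * s2 * D1 * s2 =
      s2 * s1 * s2 * D1 * s2 * D1 + s2 * D1 * s2 * D1 * s2 * s1 +
      s2 * s1 * s2 * D1 * s2 * s1)
    (h13 : D2 * s1 * s2 * s1 * D2 * s1 =
      s1 * s2 * s1 * D2 * s1 * D2 + s1 * D2 * s1 * D2 * s1 * s2 +
      s1 * s2 * s1 * D2 * s1 * s2)
    (h14 : D2 * D1 * D2 * s1 * s2 * D1 + D2 * s1 * D2 * D1 * s2 * D1 +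
      D2 * s1 * D2 * s1 * s2 * D1 + D2 * s1 * s2 * D1 * D2 * D1 +
      D2 * s1 * s2 * D1 * s2 * D1 =
      D1 * D2 * D1 * D2 * s1 * s2 + D1 * D2 * s1 * D2 * D1 * s2 +
      D1 * D2 * s1 * D2 * s1 * s2 + D1 * D2 * s1 * s2 * D1 * D2 +
      D1 * D2 * s1 * s2 * D1 * s2 + s1 * D2 * D1 * D2 * D1 * s2 +
      s1 * D2 * D1 * D2 * s1 * s2 + s1 * D2 * D1 * s2 * D1 * D2 +
      s1 * D2 * D1 * s2 * D1 * s2 + s1 * D2 * s1 * D2 * D1 * s2 +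
      s1 * D2 * s1 * D2 * s1 * s2 + s1 * D2 * s1 * s2 * D1 * D2 +
      s1 * D2 * s1 * s2 * D1 * s2 + s1 * s2 * D1 * D2 * D1 * D2 +
      s1 * s2 * D1 * D2 * D1 * s2 + s1 * s2 * D1 * s2 * D1 * D2 +
      s1 * s2 * D1 * s2 * D1 * s2)
    (h15 : s1 * D2 * s1 * D2 * D1 * D2 + s1 * D2 * D1 * D2 * s1 * D2 +
      D1 * D2 * s1 * D2 * s1 * D2 =
      D2 * s1 * D2 * s1 * D2 * D1 + D2 * s1 * D2 * D1 * D2 * s1 +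
      D2 * D1 * D2 * s1 * D2 * s1)
    (h16 : s2 * D1 * s2 * D1 * D2 * D1 + s2 * D1 * D2 * D1 * s2 * D1 +
      D2 * D1 * s2 * D1 * s2 * D1 =
      D1 * s2 * D1 * s2 * D1 * D2 + D1 * s2 * D1 * D2 * D1 * s2 +
      D1 * D2 * D1 * s2 * D1 * s2)
    (h17 : D1 * D2 * D1 * D2 * D1 * D2 = D2 * D1 * D2 * D1 * D2 * D1) :
    D2 * s1 * D2 * s1 * D2 * s1 = s1 * D2 * s1 * D2 * s1 * D2 := by
  have h1' (x : A) : s1 * (s1 * x) = x := by rw [← mul_assoc, h1, one_mul]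
  have h2' (x : A) : s2 * (s2 * x) = x := by rw [← mul_assoc, h2, one_mul]
  have hbraid := braid_of_mixed_relation_s9 (t := s1 * s2 * s1) (D := D2) (E := s1 * D2 * s1)
    (by simp only [mul_assoc, h1', h2', h1]) h5
    (by simp only [mul_assoc, h1']; rw [← mul_assoc D2 D2, h5])
    (by
      have h := congrArg (s1 * · * s1) h7
      simpa only [mul_add, add_mul, mul_sub, sub_mul, mul_assoc, h1', h1, mul_one, one_mul]
        using h)
    (by
      have h := congrArg (· * s1) h13
      simpa only [add_mul, mul_assoc, h1', h1, mul_one] using h)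
  have h := congrArg (· * s1) hbraid
  simpa only [mul_assoc, h1', h1, mul_one] using h
end

section
/- In any associative unital ring A containing elements s₁, s₂, D₁, D₂ satisfying the defining relations of the Hecke–Hopf algebra H(W₂) of type G₂ listed in the context, the identity s₁s₂D₁D₂D₁D₂ + s₁D₂D₁s₂D₁D₂ + s₁D₂D₁D₂D₁s₂ + D₁s₂s₁D₂D₁D₂ + D₁s₂D₁D₂s₁D₂ + D₁D₂s₁s₂D₁D₂ + D₁D₂s₁D₂D₁s₂ + D₁D₂D₁s₂s₁D₂ + D₁D₂D₁D₂s₁s₂ = s₂s₁D₂D₁D₂D₁ + s₂D₁D₂s₁D₂D₁ + s₂D₁D₂D₁D₂s₁ + D₂s₁s₂D₁D₂D₁ + D₂s₁D₂D₁s₂D₁ + D₂D₁s₂s₁D₂D₁ + D₂D₁s₂D₁D₂s₁ + D₂D₁D₂s₁s₂D₁ + D₂D₁D₂D₁s₂s₁ holds. (Lemma 3.2, relation (3.21).) -/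
/-- A rewriting rule for a product of two factors, applied inside a right-associated product. -/
theorem mul_mul_eq_of_mul_eq {A : Type*} [Semigroup A] {x y z : A} (h : x * y = z) (r : A) :
    x * (y * r) = z * r := by
  rw [← mul_assoc, h]

/-- If `D` commutes with `t s t s t` for involutions `s`, `t`, then `t` commutes with the
conjugate of `D` by `s t`. -/
theorem mul_conj_comm_of_involutive {A : Type*} [Monoid A] {s t D : A}
    (hs : s * s = 1) (ht : t * t = 1)
    (hD : D * t * s * t * s * t = t * s * t * s * t * D) :
    t * (s * t * D * t * s) = s * t * D * t * s * t := by
  have hs' := mul_mul_eq_of_mul_eq hs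
  have ht' := mul_mul_eq_of_mul_eq ht
  have h := congrArg (fun x => s * t * x * t * s) hD
  simp only [mul_assoc, hs, ht, hs', ht', one_mul, mul_one] at h ⊢
  exact h.symm

set_option maxHeartbeats 2000000 in
theorem stmt_10 {A : Type*} [Ring A] (s1 s2 D1 D2 : A)
    (h1 : s1 * s1 = 1) (h2 : s2 * s2 = 1)
    (h3 : s1 * s2 * s1 * s2 * s1 * s2 = s2 * s1 * s2 * s1 * s2 * s1)
    (h4 : D1 * D1 = D1) (h5 : D2 * D2 = D2)
    (h6 : s1 * D1 + D1 * s1 = s1 - 1) (h7 : s2 * D2 + D2 * s2 = s2 - 1)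
    (h8 : D1 * s2 * s1 * s2 * s1 * s2 = s2 * s1 * s2 * s1 * s2 * D1)
    (h9 : D2 * s1 * s2 * s1 * s2 * s1 = s1 * s2 * s1 * s2 * s1 * D2)
    (h10 : D1 * s2 * s1 * s2 * s1 * D2 =
      D2 * D1 * s2 * s1 * s2 * s1 + s2 * D1 * D2 * s1 * s2 * s1 +
      s2 * s1 * D2 * D1 * s2 * s1 + s2 * s1 * s2 * D1 * D2 * s1 +
      s2 * s1 * s2 * s1 * D2 * D1 + s2 * s1 * D2 * s1 * s2 * s1 +
      s2 * s1 * s2 * s1 * D2 * s1 + s2 * D1 * s2 * s1 * s2 * s1 +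
      s2 * s1 * s2 * D1 * s2 * s1)
    (h11 : D2 * s1 * s2 * D1 * s2 * s1 = s1 * s2 * D1 * s2 * s1 * D2)
    (h12 : D1 * s2 * s1 * s2 * D1 * s2 =
      s2 * s1 * s2 * D1 * s2 * D1 + s2 * D1 * s2 * D1 * s2 * s1 +
      s2 * s1 * s2 * D1 * s2 * s1)
    (h13 : D2 * s1 * s2 * s1 * D2 * s1 =
      s1 * s2 * s1 * D2 * s1 * D2 + s1 * D2 * s1 * D2 * s1 * s2 +
      s1 * s2 * s1 * D2 * s1 * s2)
    (h14 : D2 * D1 * D2 * s1 * s2 * D1 + D2 * s1 * D2 * D1 * s2 * D1 +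
      D2 * s1 * D2 * s1 * s2 * D1 + D2 * s1 * s2 * D1 * D2 * D1 +
      D2 * s1 * s2 * D1 * s2 * D1 =
      D1 * D2 * D1 * D2 * s1 * s2 + D1 * D2 * s1 * D2 * D1 * s2 +
      D1 * D2 * s1 * D2 * s1 * s2 + D1 * D2 * s1 * s2 * D1 * D2 +
      D1 * D2 * s1 * s2 * D1 * s2 + s1 * D2 * D1 * D2 * D1 * s2 +
      s1 * D2 * D1 * D2 * s1 * s2 + s1 * D2 * D1 * s2 * D1 * D2 +
      s1 * D2 * D1 * s2 * D1 * s2 + s1 * D2 * s1 * D2 * D1 * s2 +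
      s1 * D2 * s1 * D2 * s1 * s2 + s1 * D2 * s1 * s2 * D1 * D2 +
      s1 * D2 * s1 * s2 * D1 * s2 + s1 * s2 * D1 * D2 * D1 * D2 +
      s1 * s2 * D1 * D2 * D1 * s2 + s1 * s2 * D1 * s2 * D1 * D2 +
      s1 * s2 * D1 * s2 * D1 * s2)
    (h15 : s1 * D2 * s1 * D2 * D1 * D2 + s1 * D2 * D1 * D2 * s1 * D2 +
      D1 * D2 * s1 * D2 * s1 * D2 =
      D2 * s1 * D2 * s1 * D2 * D1 + D2 * s1 * D2 * D1 * D2 * s1 +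
      D2 * D1 * D2 * s1 * D2 * s1)
    (h16 : s2 * D1 * s2 * D1 * D2 * D1 + s2 * D1 * D2 * D1 * s2 * D1 +
      D2 * D1 * s2 * D1 * s2 * D1 =
      D1 * s2 * D1 * s2 * D1 * D2 + D1 * s2 * D1 * D2 * D1 * s2 +
      D1 * D2 * D1 * s2 * D1 * s2)
    (h17 : D1 * D2 * D1 * D2 * D1 * D2 = D2 * D1 * D2 * D1 * D2 * D1) :
    s1 * s2 * D1 * D2 * D1 * D2 + s1 * D2 * D1 * s2 * D1 * D2 +
      s1 * D2 * D1 * D2 * D1 * s2 + D1 * s2 * s1 * D2 * D1 * D2 +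
      D1 * s2 * D1 * D2 * s1 * D2 + D1 * D2 * s1 * s2 * D1 * D2 +
      D1 * D2 * s1 * D2 * D1 * s2 + D1 * D2 * D1 * s2 * s1 * D2 +
      D1 * D2 * D1 * D2 * s1 * s2 =
      s2 * s1 * D2 * D1 * D2 * D1 + s2 * D1 * D2 * s1 * D2 * D1 +
      s2 * D1 * D2 * D1 * D2 * s1 + D2 * s1 * s2 * D1 * D2 * D1 +
      D2 * s1 * D2 * D1 * s2 * D1 + D2 * D1 * s2 * s1 * D2 * D1 +
      D2 * D1 * s2 * D1 * D2 * s1 + D2 * D1 * D2 * s1 * s2 * D1 +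
      D2 * D1 * D2 * D1 * s2 * s1 := by
  obtain ⟨a1, ha1⟩ : ∃ x, x = s2 * D1 * s2 := ⟨_, rfl⟩
  obtain ⟨a2, ha2⟩ : ∃ x, x = s1 * s2 * D1 * s2 * s1 := ⟨_, rfl⟩
  obtain ⟨b1, hb1⟩ : ∃ x, x = s1 * D2 * s1 := ⟨_, rfl⟩
  obtain ⟨b2, hb2⟩ : ∃ x, x = s2 * s1 * D2 * s1 * s2 := ⟨_, rfl⟩
  have h1' := mul_mul_eq_of_mul_eq h1
  have h2' := mul_mul_eq_of_mul_eq h2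
  -- moving the reflections to the right of the conjugates of `D1` and `D2`
  have m1 : s1 * D1 = s1 - 1 - D1 * s1 := eq_sub_of_add_eq h6
  have m2 : s1 * a1 = a2 * s1 := by
    rw [ha1, ha2]; simp only [mul_assoc, h1, mul_one]
  have m3 : s1 * a2 = a1 * s1 := by
    rw [ha1, ha2]; simp only [mul_assoc, h1', one_mul]
  have m4 : s1 * D2 = b1 * s1 := by
    rw [hb1]; simp only [mul_assoc, h1, mul_one]
  have m5 : s1 * b1 = D2 * s1 := by
    rw [hb1]; simp only [mul_assoc, h1', one_mul]
  have m6 : s1 * b2 = b2 * s1 := by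
    rw [hb2]; exact mul_conj_comm_of_involutive h2 h1 h9
  have n1 : s2 * D2 = s2 - 1 - D2 * s2 := eq_sub_of_add_eq h7
  have n2 : s2 * b1 = b2 * s2 := by
    rw [hb1, hb2]; simp only [mul_assoc, h2, mul_one]
  have n3 : s2 * b2 = b1 * s2 := by
    rw [hb1, hb2]; simp only [mul_assoc, h2', one_mul]
  have n4 : s2 * D1 = a1 * s2 := by
    rw [ha1]; simp only [mul_assoc, h2, mul_one]
  have n5 : s2 * a1 = D1 * s2 := by
    rw [ha1]; simp only [mul_assoc, h2', one_mul]
  have n6 : s2 * a2 = a2 * s2 := by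
    rw [ha2]; exact mul_conj_comm_of_involutive h1 h2 h8
  have m1' := mul_mul_eq_of_mul_eq m1
  have m2' := mul_mul_eq_of_mul_eq m2
  have m3' := mul_mul_eq_of_mul_eq m3
  have m4' := mul_mul_eq_of_mul_eq m4
  have m5' := mul_mul_eq_of_mul_eq m5
  have m6' := mul_mul_eq_of_mul_eq m6
  have n2' := mul_mul_eq_of_mul_eq n2
  have n3' := mul_mul_eq_of_mul_eq n3
  have n4' := mul_mul_eq_of_mul_eq n4
  have n5' := mul_mul_eq_of_mul_eq n5
  have n6' := mul_mul_eq_of_mul_eq n6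
  clear ha1 ha2 hb1 hb2
  have q1 : a1 * a1 = a1 := by
    have h := congrArg (fun x => s2 * x * s2) h4
    simp only [mul_assoc, mul_one, h2, n4, n4'] at h
    exact h
  have q2 : a2 * a2 = a2 := by
    have h := congrArg (fun x => s1 * x * s1) q1
    simp only [mul_assoc, mul_one, h1, m2, m2'] at h
    exact h
  have q3 : b1 * b1 = b1 := by
    have h := congrArg (fun x => s1 * x * s1) h5
    simp only [mul_assoc, mul_one, h1, m4, m4'] at h
    exact h
  have q4 : b2 * b2 = b2 := by
    have h := congrArg (fun x => s2 * x * s2) q3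
    simp only [mul_assoc, mul_one, h2, n2, n2'] at h
    exact h
  have c1 : D2 * a2 = a2 * D2 := by
    simpa only [mul_assoc, mul_one, h1, h2, n4, m2'] using h11
  have c2 : a1 * b1 = b1 * a1 := by
    have h := congrArg (fun x => s1 * x * s1) c1
    simp only [mul_assoc, mul_one, h1, m3, m4, m3', m4'] at h
    exact h.symm
  have c3 : b2 * D1 = D1 * b2 := by
    have h := congrArg (fun x => s2 * x * s2) c2
    simp only [mul_assoc, mul_one, h2, n2, n5, n2', n5'] at h
    exact h.symm
  have r1 : a1 * D1 = D1 * a2 + a2 * a1 - a2 := by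
    have h := congrArg (fun x => x * s1 * s2) h12
    simp only [mul_assoc, add_mul, mul_sub, sub_mul, mul_one, h1, h2, m1, n4, m2', n4', n6'] at h
    linear_combination (norm := abel) -h
  have r2 : a1 * a2 = D1 * a1 - a2 * D1 + a2 := by
    have h := congrArg (fun x => s2 * x * s2) r1
    simp only [mul_assoc, mul_add, add_mul, mul_sub, sub_mul, mul_one, h2, n4, n5, n6, n4',
      n5', n6'] at h
    linear_combination (norm := abel) -h
  have r3 : D2 * b2 = b1 * D2 - b2 * b1 + b2 := by
    have h := congrArg (fun x => x * s2 * s1) h13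
    simp only [mul_assoc, add_mul, mul_sub, sub_mul, mul_one, h1, h2, m4, n1, m4', m6', n2'] at h
    linear_combination (norm := abel) h
  have r4 : D2 * b1 = b1 * b2 + b2 * D2 - b2 := by
    have h := congrArg (fun x => s1 * x * s1) r3
    simp only [mul_assoc, mul_add, add_mul, mul_sub, sub_mul, mul_one, h1, m4, m5, m6, m4',
      m5', m6'] at h
    linear_combination (norm := abel) -h
  have r5 : D2 * D1 = D1 * b1 + a1 * D2 + a2 * b2 + b1 * a2 + b2 * a1 - a1 - a2 - b1 - b2 := by
    have h := congrArg (fun x => x * s1 * s2 * s1 * s2) h10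
    simp only [mul_assoc, add_mul, mul_sub, sub_mul, mul_one, h1, h2, m1, m4, n1, n4, m2',
      m4', m6', n2', n3', n4', n6'] at h
    linear_combination (norm := abel) -h
  have r6 : D2 * a1 = D1 * D2 - a1 * b2 - a2 * b1 - b1 * D1 - b2 * a2 + a1 + a2 + b1 + b2 := by
    have h := congrArg (fun x => s1 * x * s1) r5
    simp only [mul_assoc, mul_add, add_mul, mul_sub, sub_mul, one_mul, mul_one, h1, m1, m2,
      m3, m4, m5, m6, m1', m2', m3', m4', m5', m6'] at h
    linear_combination (norm := abel) -h
  have h4' := mul_mul_eq_of_mul_eq h4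
  have h5' := mul_mul_eq_of_mul_eq h5
  have q1' := mul_mul_eq_of_mul_eq q1
  have q2' := mul_mul_eq_of_mul_eq q2
  have q3' := mul_mul_eq_of_mul_eq q3
  have q4' := mul_mul_eq_of_mul_eq q4
  have c1' := mul_mul_eq_of_mul_eq c1
  have c2' := mul_mul_eq_of_mul_eq c2
  have c3' := mul_mul_eq_of_mul_eq c3
  have r1' := mul_mul_eq_of_mul_eq r1
  have r2' := mul_mul_eq_of_mul_eq r2
  have r3' := mul_mul_eq_of_mul_eq r3
  have r4' := mul_mul_eq_of_mul_eq r4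
  have r5' := mul_mul_eq_of_mul_eq r5
  have r6' := mul_mul_eq_of_mul_eq r6
  have h := congrArg (fun x => s1 * x * s1) h14
  simp only [mul_assoc, mul_add, add_mul, mul_sub, sub_mul, one_mul, mul_one, h1, h2, h1',
      m1, m2, m3, m4, n1, n4, m1', m2', m3', m4', m5', n2', n4']
    at h h14 ⊢
  simp only [mul_assoc, mul_add, add_mul, mul_sub, sub_mul, c1, c2, c3, h4', h5', q1', q2',
      q3', q4', c1', c2', c3', r1', r2', r3', r4', r5', r6']
    at h h14 ⊢
  linear_combination (norm := abel) h - h14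
end

section
/- In any associative unital ring A containing elements s₁, s₂, D₁, D₂ satisfying the defining relations of the Hecke–Hopf algebra H(W₂) of type G₂ listed in the context, the identity s₁D₂D₁D₂D₁D₂ + D₁D₂s₁D₂D₁D₂ + D₁D₂D₁D₂s₁D₂ = D₂s₁D₂D₁D₂D₁ + D₂D₁D₂s₁D₂D₁ + D₂D₁D₂D₁D₂s₁ holds. (Lemma 3.2, relation (3.22).) -/
theorem stmt_11 {A : Type*} [Ring A] (s1 s2 D1 D2 : A)
    (h1 : s1 * s1 = 1) (h2 : s2 * s2 = 1)
    (h3 : s1 * s2 * s1 * s2 * s1 * s2 = s2 * s1 * s2 * s1 * s2 * s1)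
    (h4 : D1 * D1 = D1) (h5 : D2 * D2 = D2)
    (h6 : s1 * D1 + D1 * s1 = s1 - 1) (h7 : s2 * D2 + D2 * s2 = s2 - 1)
    (h8 : D1 * s2 * s1 * s2 * s1 * s2 = s2 * s1 * s2 * s1 * s2 * D1)
    (h9 : D2 * s1 * s2 * s1 * s2 * s1 = s1 * s2 * s1 * s2 * s1 * D2)
    (h10 : D1 * s2 * s1 * s2 * s1 * D2 =
      D2 * D1 * s2 * s1 * s2 * s1 + s2 * D1 * D2 * s1 * s2 * s1 +
      s2 * s1 * D2 * D1 * s2 * s1 + s2 * s1 * s2 * D1 * D2 * s1 +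
      s2 * s1 * s2 * s1 * D2 * D1 + s2 * s1 * D2 * s1 * s2 * s1 +
      s2 * s1 * s2 * s1 * D2 * s1 + s2 * D1 * s2 * s1 * s2 * s1 +
      s2 * s1 * s2 * D1 * s2 * s1)
    (h11 : D2 * s1 * s2 * D1 * s2 * s1 = s1 * s2 * D1 * s2 * s1 * D2)
    (h12 : D1 * s2 * s1 * s2 * D1 * s2 =
      s2 * s1 * s2 * D1 * s2 * D1 + s2 * D1 * s2 * D1 * s2 * s1 +
      s2 * s1 * s2 * D1 * s2 * s1)
    (h13 : D2 * s1 * s2 * s1 * D2 * s1 =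
      s1 * s2 * s1 * D2 * s1 * D2 + s1 * D2 * s1 * D2 * s1 * s2 +
      s1 * s2 * s1 * D2 * s1 * s2)
    (h14 : D2 * D1 * D2 * s1 * s2 * D1 + D2 * s1 * D2 * D1 * s2 * D1 +
      D2 * s1 * D2 * s1 * s2 * D1 + D2 * s1 * s2 * D1 * D2 * D1 +
      D2 * s1 * s2 * D1 * s2 * D1 =
      D1 * D2 * D1 * D2 * s1 * s2 + D1 * D2 * s1 * D2 * D1 * s2 +
      D1 * D2 * s1 * D2 * s1 * s2 + D1 * D2 * s1 * s2 * D1 * D2 +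
      D1 * D2 * s1 * s2 * D1 * s2 + s1 * D2 * D1 * D2 * D1 * s2 +
      s1 * D2 * D1 * D2 * s1 * s2 + s1 * D2 * D1 * s2 * D1 * D2 +
      s1 * D2 * D1 * s2 * D1 * s2 + s1 * D2 * s1 * D2 * D1 * s2 +
      s1 * D2 * s1 * D2 * s1 * s2 + s1 * D2 * s1 * s2 * D1 * D2 +
      s1 * D2 * s1 * s2 * D1 * s2 + s1 * s2 * D1 * D2 * D1 * D2 +
      s1 * s2 * D1 * D2 * D1 * s2 + s1 * s2 * D1 * s2 * D1 * D2 +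
      s1 * s2 * D1 * s2 * D1 * s2)
    (h15 : s1 * D2 * s1 * D2 * D1 * D2 + s1 * D2 * D1 * D2 * s1 * D2 +
      D1 * D2 * s1 * D2 * s1 * D2 =
      D2 * s1 * D2 * s1 * D2 * D1 + D2 * s1 * D2 * D1 * D2 * s1 +
      D2 * D1 * D2 * s1 * D2 * s1)
    (h16 : s2 * D1 * s2 * D1 * D2 * D1 + s2 * D1 * D2 * D1 * s2 * D1 +
      D2 * D1 * s2 * D1 * s2 * D1 =
      D1 * s2 * D1 * s2 * D1 * D2 + D1 * s2 * D1 * D2 * D1 * s2 +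
      D1 * D2 * D1 * s2 * D1 * s2)
    (h17 : D1 * D2 * D1 * D2 * D1 * D2 = D2 * D1 * D2 * D1 * D2 * D1) :
    s1 * D2 * D1 * D2 * D1 * D2 + D1 * D2 * s1 * D2 * D1 * D2 +
      D1 * D2 * D1 * D2 * s1 * D2 =
      D2 * s1 * D2 * D1 * D2 * D1 + D2 * D1 * D2 * s1 * D2 * D1 +
      D2 * D1 * D2 * D1 * D2 * s1 := by
  have idem (x : A) : D2 * (D2 * x) = D2 * x := by rw [← mul_assoc, h5]
  have swap : D2 * s2 = s2 - 1 - s2 * D2 := by rw [← h7]; abel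
  have e14 := sub_eq_zero.mpr h14
  have e13 := sub_eq_zero.mpr h13
  have e15 := sub_eq_zero.mpr h15
  rw [← sub_eq_zero]
  -- Combine the relations as `D2 * (h14 - h13) * s2 - (h14 - h13) * s2 * D2 - h15`.
  have key : ∀ p q r : A, p = 0 → q = 0 → r = 0 →
      D2 * (p - q) * s2 - (p - q) * s2 * D2 - r = 0 := by
    rintro _ _ _ rfl rfl rfl
    simp
  refine Eq.trans ?_ (key _ _ _ e14 e13 e15)
  simp only [mul_add, add_mul, mul_sub, sub_mul, mul_assoc, mul_one, h2, h5, idem, swap]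
  abel
end

section
/- In any associative unital ring A containing elements s₁, s₂, D₁, D₂ satisfying the defining relations of the Hecke–Hopf algebra H(W₂) of type G₂ listed in the context, the identity D₁s₂D₁D₂D₁D₂ + D₁D₂D₁s₂D₁D₂ + D₁D₂D₁D₂D₁s₂ = s₂D₁D₂D₁D₂D₁ + D₂D₁s₂D₁D₂D₁ + D₂D₁D₂D₁s₂D₁ holds. (Lemma 3.2, relation (3.23).) -/
/-- A three-term quadratic relation between two idempotents forces a braid relation. -/
theorem braid_of_quadratic {A : Type*} [Ring A] {a e f : A} (ha : a * a = a) (he : e * e = e)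
    (h : e * a = a * f + f * e - f) : a * e * a = e * a * e := by
  rw [mul_assoc, h]
  simp only [mul_add, mul_sub, add_mul, sub_mul, mul_assoc, he]
  simp only [← mul_assoc, ha]
  abel

/-- In a ring with idempotents `a`, `e`, commuting the quartic relation `Q = 0` past `a` and `e`,
in the form `Q * e - a * Q = 0`, yields a quintic relation not involving `g`. -/
theorem quintic_of_quartic {A : Type*} [Ring A] {a d e g : A} (ha : a * a = a) (he : e * e = e)
    (hQ : a * g * a * g + a * g * e * d + g * a * g * e + g * e * d * e + e * d * e * d
        + d * a * d * a + g * d * a + d * a * e + g + e =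
      a * g * d * a + g * d * a * e + d * a * e * d + a * g * e + g * a * g + g * e * d
        + e * d * e + a * g + g * e + e * d) :
    a * e * d * e * d + a * d * a * d * a + d * a * e * d * e + a * d * a * e + e * d * e
        + e * d * e + a * e =
      a * d * a * e * d + e * d * e * d * e + d * a * d * a * e + a * e * d * e + a * e * d
        + d * a * e + e := by
  have h₁ := congrArg (· * e) hQ
  have h₂ := congrArg (a * ·) hQ
  have he' (x : A) : e * (e * x) = e * x := by rw [← mul_assoc, he]
  have ha' (x : A) : a * (a * x) = a * x := by rw [← mul_assoc, ha]
  simp only [add_mul, mul_add, mul_assoc, he, ha'] at h₁ h₂ ⊢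
  linear_combination (norm := abel) h₂ - h₁

theorem stmt_12 {A : Type*} [Ring A] (s1 s2 D1 D2 : A)
    (h1 : s1 * s1 = 1) (h2 : s2 * s2 = 1)
    (h3 : s1 * s2 * s1 * s2 * s1 * s2 = s2 * s1 * s2 * s1 * s2 * s1)
    (h4 : D1 * D1 = D1) (h5 : D2 * D2 = D2)
    (h6 : s1 * D1 + D1 * s1 = s1 - 1) (h7 : s2 * D2 + D2 * s2 = s2 - 1)
    (h8 : D1 * s2 * s1 * s2 * s1 * s2 = s2 * s1 * s2 * s1 * s2 * D1)
    (h9 : D2 * s1 * s2 * s1 * s2 * s1 = s1 * s2 * s1 * s2 * s1 * D2)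
    (h10 : D1 * s2 * s1 * s2 * s1 * D2 =
      D2 * D1 * s2 * s1 * s2 * s1 + s2 * D1 * D2 * s1 * s2 * s1 +
      s2 * s1 * D2 * D1 * s2 * s1 + s2 * s1 * s2 * D1 * D2 * s1 +
      s2 * s1 * s2 * s1 * D2 * D1 + s2 * s1 * D2 * s1 * s2 * s1 +
      s2 * s1 * s2 * s1 * D2 * s1 + s2 * D1 * s2 * s1 * s2 * s1 +
      s2 * s1 * s2 * D1 * s2 * s1)
    (h11 : D2 * s1 * s2 * D1 * s2 * s1 = s1 * s2 * D1 * s2 * s1 * D2)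
    (h12 : D1 * s2 * s1 * s2 * D1 * s2 =
      s2 * s1 * s2 * D1 * s2 * D1 + s2 * D1 * s2 * D1 * s2 * s1 +
      s2 * s1 * s2 * D1 * s2 * s1)
    (h13 : D2 * s1 * s2 * s1 * D2 * s1 =
      s1 * s2 * s1 * D2 * s1 * D2 + s1 * D2 * s1 * D2 * s1 * s2 +
      s1 * s2 * s1 * D2 * s1 * s2)
    (h14 : D2 * D1 * D2 * s1 * s2 * D1 + D2 * s1 * D2 * D1 * s2 * D1 +
      D2 * s1 * D2 * s1 * s2 * D1 + D2 * s1 * s2 * D1 * D2 * D1 +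
      D2 * s1 * s2 * D1 * s2 * D1 =
      D1 * D2 * D1 * D2 * s1 * s2 + D1 * D2 * s1 * D2 * D1 * s2 +
      D1 * D2 * s1 * D2 * s1 * s2 + D1 * D2 * s1 * s2 * D1 * D2 +
      D1 * D2 * s1 * s2 * D1 * s2 + s1 * D2 * D1 * D2 * D1 * s2 +
      s1 * D2 * D1 * D2 * s1 * s2 + s1 * D2 * D1 * s2 * D1 * D2 +
      s1 * D2 * D1 * s2 * D1 * s2 + s1 * D2 * s1 * D2 * D1 * s2 +
      s1 * D2 * s1 * D2 * s1 * s2 + s1 * D2 * s1 * s2 * D1 * D2 +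
      s1 * D2 * s1 * s2 * D1 * s2 + s1 * s2 * D1 * D2 * D1 * D2 +
      s1 * s2 * D1 * D2 * D1 * s2 + s1 * s2 * D1 * s2 * D1 * D2 +
      s1 * s2 * D1 * s2 * D1 * s2)
    (h15 : s1 * D2 * s1 * D2 * D1 * D2 + s1 * D2 * D1 * D2 * s1 * D2 +
      D1 * D2 * s1 * D2 * s1 * D2 =
      D2 * s1 * D2 * s1 * D2 * D1 + D2 * s1 * D2 * D1 * D2 * s1 +
      D2 * D1 * D2 * s1 * D2 * s1)
    (h16 : s2 * D1 * s2 * D1 * D2 * D1 + s2 * D1 * D2 * D1 * s2 * D1 +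
      D2 * D1 * s2 * D1 * s2 * D1 =
      D1 * s2 * D1 * s2 * D1 * D2 + D1 * s2 * D1 * D2 * D1 * s2 +
      D1 * D2 * D1 * s2 * D1 * s2)
    (h17 : D1 * D2 * D1 * D2 * D1 * D2 = D2 * D1 * D2 * D1 * D2 * D1) :
    D1 * s2 * D1 * D2 * D1 * D2 + D1 * D2 * D1 * s2 * D1 * D2 +
      D1 * D2 * D1 * D2 * D1 * s2 =
      s2 * D1 * D2 * D1 * D2 * D1 + D2 * D1 * s2 * D1 * D2 * D1 +
      D2 * D1 * D2 * D1 * s2 * D1 := by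
  obtain ⟨E, hE⟩ : ∃ E, E = s2 * D1 * s2 := ⟨_, rfl⟩
  obtain ⟨F, hF⟩ : ∃ F, F = s1 * E * s1 := ⟨_, rfl⟩
  obtain ⟨G, hG⟩ : ∃ G, G = s1 * D2 * s1 := ⟨_, rfl⟩
  have assoc {x y z : A} (h : x * y = z) (t : A) : x * (y * t) = z * t := by rw [← mul_assoc, h]
  have c₁ : s1 * D1 = s1 - 1 - D1 * s1 := eq_sub_of_add_eq h6
  have c₂ : s2 * D2 = s2 - 1 - D2 * s2 := eq_sub_of_add_eq h7
  have c₃ : s2 * D1 = E * s2 := by rw [hE, mul_assoc, h2, mul_one]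
  have c₄ : s2 * E = D1 * s2 := by rw [hE, ← mul_assoc, ← mul_assoc, h2, one_mul]
  have c₅ : s1 * E = F * s1 := by rw [hF, mul_assoc, h1, mul_one]
  have c₆ : s1 * F = E * s1 := by rw [hF, ← mul_assoc, ← mul_assoc, h1, one_mul]
  have c₇ : s1 * D2 = G * s1 := by rw [hG, mul_assoc, h1, mul_one]
  have c₈ : s1 * G = D2 * s1 := by rw [hG, ← mul_assoc, ← mul_assoc, h1, one_mul]
  have c₉ : s2 * F = F * s2 := by
    have h := congrArg (fun x => s2 * s1 * s2 * x * s2 * s1 * s2) h8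
    simpa only [hF, hE, mul_assoc, assoc h1, assoc h2, h1, h2, mul_one, one_mul] using h
  have hEE : E * E = E := by
    have h : s2 * D1 * s2 * E = E := by
      rw [mul_assoc (s2 * D1), c₄, ← mul_assoc, mul_assoc s2, h4, hE]
    rwa [← hE] at h
  have hGG : G * G = G := by
    have h : s1 * D2 * s1 * G = G := by
      rw [mul_assoc (s1 * D2), c₈, ← mul_assoc, mul_assoc s1, h5, hG]
    rwa [← hG] at h
  have hEDE : D1 * E * D1 = E * D1 * E := by
    apply braid_of_quadratic (f := F) h4 hEE
    have h := congrArg (· * (s1 * s2)) h12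
    simp only [add_mul, mul_sub, sub_mul, mul_one, one_mul, mul_assoc, assoc h1, h1, h2, c₃,
      assoc c₁, assoc c₃, assoc c₅, assoc c₉] at h
    linear_combination (norm := abel) -h
  have hQ := congrArg (fun x => s1 * x * s2) h14
  simp only [mul_add, add_mul, mul_sub, sub_mul, mul_one, one_mul, mul_assoc, assoc h1, h1, h2,
    assoc h5, hEE, assoc hEE, assoc hGG, c₁, c₂, c₃, c₅, c₆, c₇, assoc c₁, assoc c₅, assoc c₆,
    assoc c₇, assoc c₈] at hQ
  have hT := quintic_of_quartic (a := D1) (d := D2) (e := E) (g := G) h4 hEE (by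
    simp only [mul_assoc]
    linear_combination (norm := abel) -hQ)
  replace hT := congrArg (· * s2) hT
  replace hEDE := congrArg (· * s2) hEDE
  simp only [add_mul, mul_sub, sub_mul, mul_one, mul_assoc, h2, assoc hEE, c₂, c₃]
    at h16 hT hEDE ⊢
  linear_combination (norm := abel) hT + h16 - hEDE
end

section
/- In any associative unital ring A containing elements s₁, s₂, D₁, D₂ satisfying the defining relations of the Hecke–Hopf algebra H(W₃) of type I₂(5) listed in the context, the identity D₂s₁s₂D₁s₂ + s₂D₁s₂s₁D₂ = s₁D₂s₁D₂s₁ + D₁s₂D₁s₂s₁ + s₁s₂D₁s₂D₁ + s₁s₂D₁s₂s₁ holds. (Lemma 4.2, relation (4.10).) -/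
theorem stmt_17 {A : Type*} [Ring A] (s1 s2 D1 D2 : A)
    (h1 : s1 * s1 = 1) (h2 : s2 * s2 = 1)
    (h3 : s1 * s2 * s1 * s2 * s1 = s2 * s1 * s2 * s1 * s2)
    (h4 : D1 * D1 = D1) (h5 : D2 * D2 = D2)
    (h6 : s1 * D1 + D1 * s1 = s1 - 1) (h7 : s2 * D2 + D2 * s2 = s2 - 1)
    (h8 : D2 * s1 * s2 * s1 * s2 = s1 * s2 * s1 * s2 * D1)
    (h9 : D2 * s1 * s2 * s1 * D2 =
      D1 * D2 * s1 * s2 * s1 + s1 * D2 * D1 * s2 * s1 + s1 * D2 * s1 * s2 * s1 +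
      s1 * s2 * D1 * D2 * s1 + s1 * s2 * D1 * s2 * s1 + s1 * s2 * s1 * D2 * D1 +
      s1 * s2 * s1 * D2 * s1)
    (h10 : D1 * s2 * s1 * s2 * D1 =
      D2 * D1 * s2 * s1 * s2 + s2 * D1 * D2 * s1 * s2 + s2 * D1 * s2 * s1 * s2 +
      s2 * s1 * D2 * D1 * s2 + s2 * s1 * D2 * s1 * s2 + s2 * s1 * s2 * D1 * D2 +
      s2 * s1 * s2 * D1 * s2)
    (h11 : D1 * s2 * s1 * D2 * s1 + s1 * D2 * s1 * s2 * D1 =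
      s2 * D1 * s2 * D1 * s2 + D2 * s1 * D2 * s1 * s2 + s2 * s1 * D2 * s1 * D2 +
      s2 * s1 * D2 * s1 * s2)
    (h12 : D2 * D1 * D2 * s1 * D2 + D2 * s1 * D2 * D1 * D2 + D2 * s1 * D2 * s1 * D2 =
      D1 * D2 * D1 * D2 * s1 + D1 * D2 * s1 * D2 * D1 + D1 * D2 * s1 * D2 * s1 +
      s1 * D2 * D1 * D2 * D1 + s1 * D2 * D1 * D2 * s1 + s1 * D2 * s1 * D2 * D1 +
      s1 * D2 * s1 * D2 * s1)
    (h13 : D1 * D2 * D1 * s2 * D1 + D1 * s2 * D1 * D2 * D1 + D1 * s2 * D1 * s2 * D1 =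
      D2 * D1 * D2 * D1 * s2 + D2 * D1 * s2 * D1 * D2 + D2 * D1 * s2 * D1 * s2 +
      s2 * D1 * D2 * D1 * D2 + s2 * D1 * D2 * D1 * s2 + s2 * D1 * s2 * D1 * D2 +
      s2 * D1 * s2 * D1 * s2) :
    D2 * s1 * s2 * D1 * s2 + s2 * D1 * s2 * s1 * D2 =
      s1 * D2 * s1 * D2 * s1 + D1 * s2 * D1 * s2 * s1 + s1 * s2 * D1 * s2 * D1 +
      s1 * s2 * D1 * s2 * s1 := by
  have c1 (x : A) : s1 * (s1 * x) = x := by rw [← mul_assoc, h1, one_mul]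
  have c2 (x : A) : s2 * (s2 * x) = x := by rw [← mul_assoc, h2, one_mul]
  have e : s1 * s2 * s1 * D2 * s1 * s2 = s2 * D1 * s2 * s1 := by
    have h := congrArg (fun x => s1 * s2 * s1 * x * s2 * s1) h8
    simpa only [mul_assoc, c1, c2, h1, h2, mul_one] using h
  have e' : s2 * s1 * D2 * s1 * s2 = s1 * s2 * D1 * s2 * s1 := by
    have h := congrArg (fun x => s1 * x) e
    simpa only [mul_assoc, c1] using h
  have sD1 : s1 * D1 = s1 - 1 - D1 * s1 := eq_sub_of_add_eq h6
  have sD2 : D2 * s2 = s2 - 1 - s2 * D2 := eq_sub_of_add_eq' h7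
  have t1 : s1 * (D1 * s2 * s1 * D2 * s1) * s2 =
      s2 * D1 * s2 * s1 - s1 * s2 * D1 * s2 * s1 - D1 * s2 * D1 * s2 * s1 :=
    calc s1 * (D1 * s2 * s1 * D2 * s1) * s2
        = (s1 * D1) * (s2 * s1 * D2 * s1 * s2) := by simp only [mul_assoc]
      _ = _ := by
        rw [sD1, e']
        simp only [sub_mul, one_mul, mul_assoc, c1]
  have t2 : s1 * (s2 * s1 * D2 * s1 * D2) * s2 =
      s2 * D1 * s2 * s1 - s1 * s2 * s1 * D2 * s1 - s2 * D1 * s2 * s1 * D2 :=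
    calc s1 * (s2 * s1 * D2 * s1 * D2) * s2
        = s1 * s2 * s1 * D2 * s1 * (D2 * s2) := by simp only [mul_assoc]
      _ = s1 * s2 * s1 * D2 * s1 * s2 - s1 * s2 * s1 * D2 * s1 -
          s1 * s2 * s1 * D2 * s1 * s2 * D2 := by
        rw [sD2]
        simp only [mul_sub, mul_one, mul_assoc]
      _ = _ := by rw [e]
  have h := congrArg (fun x => s1 * x * s2) h11
  simp only [mul_add, add_mul, t1, t2] at h
  simp only [mul_assoc, c1, h2, mul_one] at h ⊢
  rw [← sub_eq_zero] at h ⊢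
  rw [← h]
  abel
end

section
/- In any associative unital ring A containing elements s₁, s₂, D₁, D₂ satisfying the defining relations of the Hecke–Hopf algebra H(W₃) of type I₂(5) listed in the context, the identity s₁D₂D₁D₂D₁ + D₁s₂D₁D₂D₁ + D₁D₂s₁D₂D₁ + D₁D₂D₁s₂D₁ + D₁D₂D₁D₂s₁ = s₂D₁D₂D₁D₂ + D₂s₁D₂D₁D₂ + D₂D₁s₂D₁D₂ + D₂D₁D₂s₁D₂ + D₂D₁D₂D₁s₂ holds. (Lemma 4.2, relation (4.16).) -/
theorem stmt_18 {A : Type*} [Ring A] (s1 s2 D1 D2 : A)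
    (h1 : s1 * s1 = 1) (h2 : s2 * s2 = 1)
    (h3 : s1 * s2 * s1 * s2 * s1 = s2 * s1 * s2 * s1 * s2)
    (h4 : D1 * D1 = D1) (h5 : D2 * D2 = D2)
    (h6 : s1 * D1 + D1 * s1 = s1 - 1) (h7 : s2 * D2 + D2 * s2 = s2 - 1)
    (h8 : D2 * s1 * s2 * s1 * s2 = s1 * s2 * s1 * s2 * D1)
    (h9 : D2 * s1 * s2 * s1 * D2 =
      D1 * D2 * s1 * s2 * s1 + s1 * D2 * D1 * s2 * s1 + s1 * D2 * s1 * s2 * s1 +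
      s1 * s2 * D1 * D2 * s1 + s1 * s2 * D1 * s2 * s1 + s1 * s2 * s1 * D2 * D1 +
      s1 * s2 * s1 * D2 * s1)
    (h10 : D1 * s2 * s1 * s2 * D1 =
      D2 * D1 * s2 * s1 * s2 + s2 * D1 * D2 * s1 * s2 + s2 * D1 * s2 * s1 * s2 +
      s2 * s1 * D2 * D1 * s2 + s2 * s1 * D2 * s1 * s2 + s2 * s1 * s2 * D1 * D2 +
      s2 * s1 * s2 * D1 * s2)
    (h11 : D1 * s2 * s1 * D2 * s1 + s1 * D2 * s1 * s2 * D1 =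
      s2 * D1 * s2 * D1 * s2 + D2 * s1 * D2 * s1 * s2 + s2 * s1 * D2 * s1 * D2 +
      s2 * s1 * D2 * s1 * s2)
    (h12 : D2 * D1 * D2 * s1 * D2 + D2 * s1 * D2 * D1 * D2 + D2 * s1 * D2 * s1 * D2 =
      D1 * D2 * D1 * D2 * s1 + D1 * D2 * s1 * D2 * D1 + D1 * D2 * s1 * D2 * s1 +
      s1 * D2 * D1 * D2 * D1 + s1 * D2 * D1 * D2 * s1 + s1 * D2 * s1 * D2 * D1 +
      s1 * D2 * s1 * D2 * s1)
    (h13 : D1 * D2 * D1 * s2 * D1 + D1 * s2 * D1 * D2 * D1 + D1 * s2 * D1 * s2 * D1 =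
      D2 * D1 * D2 * D1 * s2 + D2 * D1 * s2 * D1 * D2 + D2 * D1 * s2 * D1 * s2 +
      s2 * D1 * D2 * D1 * D2 + s2 * D1 * D2 * D1 * s2 + s2 * D1 * s2 * D1 * D2 +
      s2 * D1 * s2 * D1 * s2) :
    s1 * D2 * D1 * D2 * D1 + D1 * s2 * D1 * D2 * D1 + D1 * D2 * s1 * D2 * D1 +
      D1 * D2 * D1 * s2 * D1 + D1 * D2 * D1 * D2 * s1 =
      s2 * D1 * D2 * D1 * D2 + D2 * s1 * D2 * D1 * D2 + D2 * D1 * s2 * D1 * D2 +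
      D2 * D1 * D2 * s1 * D2 + D2 * D1 * D2 * D1 * s2 := by
  have reassoc {x y z : A} (h : x * y = z) (t : A) : x * (y * t) = z * t := by rw [← h, mul_assoc]
  -- Conjugates of `D1`, `D2` attached to the other three reflections of the dihedral group.
  obtain ⟨E4, hE4⟩ : ∃ E, E = s1 * D2 * s1 := ⟨_, rfl⟩
  obtain ⟨E2, hE2⟩ : ∃ E, E = s2 * D1 * s2 := ⟨_, rfl⟩
  obtain ⟨E3, hE3⟩ : ∃ E, E = s1 * E2 * s1 := ⟨_, rfl⟩
  have h_s1D1 : s1 * D1 = s1 - 1 - D1 * s1 := eq_sub_of_add_eq h6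
  have h_s2D2 : s2 * D2 = s2 - 1 - D2 * s2 := eq_sub_of_add_eq h7
  have h_s1D2 : s1 * D2 = E4 * s1 := by simp only [hE4, mul_assoc, h1, mul_one]
  have h_s2D1 : s2 * D1 = E2 * s2 := by simp only [hE2, mul_assoc, h2, mul_one]
  have h_s1E2 : s1 * E2 = E3 * s1 := by simp only [hE3, mul_assoc, h1, mul_one]
  have h_s2E4 : s2 * E4 = E3 * s2 := by
    have h : D2 = s1 * s2 * s1 * s2 * D1 * s2 * s1 * s2 * s1 := by
      rw [← h8]; simp only [mul_assoc, reassoc h2, h1, one_mul, mul_one]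
    rw [hE4, h, hE3, hE2]
    simp only [mul_assoc, reassoc h1, h1, one_mul, mul_one, reassoc h2]
  have h_s2E3 : s2 * E3 = E4 * s2 := by
    have h := congrArg (fun x => s2 * x * s2) h_s2E4
    simp only [mul_assoc, reassoc h2, h2, one_mul, mul_one] at h
    exact h.symm
  -- Two quadratic relations among `D1`, `D2`, `E2`, `E3`, `E4`.
  have hA : D1 * E4 + E4 * E3 + E3 * E2 + E2 * D2 - D2 * D1 - E2 - E3 - E4 = 0 := by
    have h := congrArg (fun x => x * (s2 * (s1 * s2))) h10
    simp only [mul_assoc, add_mul, sub_mul, mul_sub, one_mul, mul_one, reassoc h1, reassoc h2,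
      h1, h2, reassoc h_s1D2, reassoc h_s2D1, reassoc h_s1E2, reassoc h_s2E4, reassoc h_s2E3,
      h_s1D1, h_s2D2, h_s1D2, h_s2D1] at h
    rw [← sub_eq_zero] at h
    refine Eq.trans ?_ h
    abel
  have hB : D1 * E3 + E3 * D2 + E4 * E2 - D2 * E4 - E2 * D1 - E3 = 0 := by
    have h := congrArg (fun x => x * s2) h11
    simp only [mul_assoc, add_mul, sub_mul, mul_sub, mul_one,
      h1, h2, reassoc h_s2E4, h_s2D2, h_s1D2, h_s2D1] at h
    rw [← sub_eq_zero] at h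
    refine Eq.trans ?_ h
    abel
  have hE4_idem : E4 * E4 = E4 := by
    simp only [hE4, mul_assoc, reassoc h1, one_mul, reassoc h5]
  have hE2_idem : E2 * E2 = E2 := by
    simp only [hE2, mul_assoc, reassoc h2, one_mul, reassoc h4]
  linear_combination (norm := skip) h13 - h12 - hA * E2 + E4 * hA + D1 * hB - hB * D2
  simp only [mul_assoc, add_mul, mul_add, sub_mul, mul_sub, mul_one, zero_mul, mul_zero,
    h1, h2, h_s1D1, h_s2D2, h_s1D2, h_s2D1, h5, reassoc h4,
    hE4_idem, hE2_idem, reassoc hE4_idem, reassoc hE2_idem]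
  abel
end

section
/- In any associative unital ring A containing elements s₁, s₂, D₁, D₂ satisfying the defining relations of the Hecke–Hopf algebra H(W₃) of type I₂(5) listed in the context, the braid-type identity D₁D₂D₁D₂D₁ = D₂D₁D₂D₁D₂ holds. (Lemma 4.2, relation (4.17).) -/
/-- If `p`, `e` are idempotent, `f * t = t * (1 - e)`, and `T` is the difference of the two
alternating words of length five in `p`, `e`, then `f * t * T = t * T * p`. -/
theorem mul_mul_eq_mul_mul_of_alternating_sub_eq {A : Type*} [Ring A] {p e f t T : A}
    (hp : p * p = p) (he : e * e = e) (hf : f * t = t * (1 - e))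
    (hT : T = p * e * p * e * p - e * p * e * p * e) :
    f * t * T = t * T * p := by
  have hl : (1 - e) * T = (1 - e) * (p * e * p * e * p) := by
    have h : (1 - e) * T =
        (1 - e) * (p * e * p * e * p) - (e - e * e) * (p * e * p * e) := by
      rw [hT]; noncomm_ring
    rw [h, he, sub_self, zero_mul, sub_zero]
  have hr : T * p = (1 - e) * (p * e * p * e * p) := by
    have h : T * p = p * e * p * e * (p * p) - e * p * e * p * e * p := by
      rw [hT]; noncomm_ring
    rw [h, hp]; noncomm_ring
  rw [hf, mul_assoc, hl, mul_assoc t T, hr]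

/-- The difference `T` of the two alternating words of length five in idempotents `p`, `q`
satisfies `q * T + T * p = T`. -/
theorem mul_add_mul_alternating_sub {A : Type*} [Ring A] {p q : A}
    (hp : p * p = p) (hq : q * q = q) :
    q * (p * q * p * q * p - q * p * q * p * q) +
      (p * q * p * q * p - q * p * q * p * q) * p =
      p * q * p * q * p - q * p * q * p * q := by
  have h : q * (p * q * p * q * p - q * p * q * p * q) +
      (p * q * p * q * p - q * p * q * p * q) * p =
      p * q * p * q * (p * p) - q * q * p * q * p * q := by noncomm_ring
  rw [h, hp, hq]

theorem stmt_19 {A : Type*} [Ring A] (s1 s2 D1 D2 : A)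
    (h1 : s1 * s1 = 1) (h2 : s2 * s2 = 1)
    (h3 : s1 * s2 * s1 * s2 * s1 = s2 * s1 * s2 * s1 * s2)
    (h4 : D1 * D1 = D1) (h5 : D2 * D2 = D2)
    (h6 : s1 * D1 + D1 * s1 = s1 - 1) (h7 : s2 * D2 + D2 * s2 = s2 - 1)
    (h8 : D2 * s1 * s2 * s1 * s2 = s1 * s2 * s1 * s2 * D1)
    (h9 : D2 * s1 * s2 * s1 * D2 =
      D1 * D2 * s1 * s2 * s1 + s1 * D2 * D1 * s2 * s1 + s1 * D2 * s1 * s2 * s1 +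
      s1 * s2 * D1 * D2 * s1 + s1 * s2 * D1 * s2 * s1 + s1 * s2 * s1 * D2 * D1 +
      s1 * s2 * s1 * D2 * s1)
    (h10 : D1 * s2 * s1 * s2 * D1 =
      D2 * D1 * s2 * s1 * s2 + s2 * D1 * D2 * s1 * s2 + s2 * D1 * s2 * s1 * s2 +
      s2 * s1 * D2 * D1 * s2 + s2 * s1 * D2 * s1 * s2 + s2 * s1 * s2 * D1 * D2 +
      s2 * s1 * s2 * D1 * s2)
    (h11 : D1 * s2 * s1 * D2 * s1 + s1 * D2 * s1 * s2 * D1 =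
      s2 * D1 * s2 * D1 * s2 + D2 * s1 * D2 * s1 * s2 + s2 * s1 * D2 * s1 * D2 +
      s2 * s1 * D2 * s1 * s2)
    (h12 : D2 * D1 * D2 * s1 * D2 + D2 * s1 * D2 * D1 * D2 + D2 * s1 * D2 * s1 * D2 =
      D1 * D2 * D1 * D2 * s1 + D1 * D2 * s1 * D2 * D1 + D1 * D2 * s1 * D2 * s1 +
      s1 * D2 * D1 * D2 * D1 + s1 * D2 * D1 * D2 * s1 + s1 * D2 * s1 * D2 * D1 +
      s1 * D2 * s1 * D2 * s1)
    (h13 : D1 * D2 * D1 * s2 * D1 + D1 * s2 * D1 * D2 * D1 + D1 * s2 * D1 * s2 * D1 =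
      D2 * D1 * D2 * D1 * s2 + D2 * D1 * s2 * D1 * D2 + D2 * D1 * s2 * D1 * s2 +
      s2 * D1 * D2 * D1 * D2 + s2 * D1 * D2 * D1 * s2 + s2 * D1 * s2 * D1 * D2 +
      s2 * D1 * s2 * D1 * s2) :
    D1 * D2 * D1 * D2 * D1 = D2 * D1 * D2 * D1 * D2 := by
  have hs : s2 * D2 = s2 - 1 - D2 * s2 := eq_sub_of_add_eq h7
  have hf : D2 * s2 = s2 * (1 - (D2 + s2)) := by
    rw [mul_sub, mul_add, hs, h2]; noncomm_ring
  have he : (D2 + s2) * (D2 + s2) = D2 + s2 := by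
    rw [add_mul, mul_add, mul_add, hs, h2, h5]; noncomm_ring
  have hT : D1 * D2 * D1 * D2 * D1 - D2 * D1 * D2 * D1 * D2 =
      D1 * (D2 + s2) * D1 * (D2 + s2) * D1 -
        (D2 + s2) * D1 * (D2 + s2) * D1 * (D2 + s2) := by
    rw [← sub_eq_zero] at h13
    rw [eq_comm, ← sub_eq_zero, ← h13]
    noncomm_ring
  have hi := mul_mul_eq_mul_mul_of_alternating_sub_eq h4 he hf hT
  have ha := mul_add_mul_alternating_sub h4 h5
  rw [← sub_eq_zero]
  generalize D1 * D2 * D1 * D2 * D1 - D2 * D1 * D2 * D1 * D2 = T at hi ha ⊢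
  have hc : D2 * s2 = s2 - 1 - s2 * D2 := eq_sub_of_add_eq' h7
  calc T = s2 * T - s2 * (D2 * T + T * D1) - (D2 * s2 * T - s2 * T * D1) := by
        rw [hc]; noncomm_ring
    _ = 0 := by rw [ha, hi, sub_self, sub_self, sub_zero]
end
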